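/- Let f = (f_1,…,f_n) be polynomials in R[x] with each deg f_i ≥ 1, δ_f = Σ_{i=1}^n (deg f_i − 1), and let δ ≥ 0 be an integer. Let L be an R-linear functional on R[x] that annuls (f)^{≤δ_f+δ}_x. Fix monotonous difference derivatives ∇f_i of the f_i, let F ∈ (f)^{≤d}_x, and fix a monotonous difference derivative ∇F of F. Then the polynomial H(x) = L(y_*).det‖∇f(x,y) ∇F(x,y); f(x) F(x)‖ lies in (f)^{≤d−δ−1}_x. -/

import Mathlib

open MvPolynomial Finset

noncomputable section

variable {R : Type*} [CommRing R] {n : ℕ}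

/-- Total degree of a multivariate polynomial, valued in `WithBot ℤ`,
with the convention `deg 0 = ⊥` (i.e. `-∞`). -/
def mdeg {σ S : Type*} [CommSemiring S] (F : MvPolynomial σ S) : WithBot ℤ :=
  F.support.sup fun m => ((m.sum fun _ e => e : ℕ) : ℤ)

/-- The embedding `R[x] → R[x,y]`, `x_i ↦ x_i` (the x-variables are `Sum.inl`,
the y-variables are `Sum.inr`). -/
def toX : MvPolynomial (Fin n) R →ₐ[R] MvPolynomial (Fin n ⊕ Fin n) R :=
  rename Sum.inl

/-- The embedding `R[x] → R[x,y]`, `x_i ↦ y_i`. -/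
def toY : MvPolynomial (Fin n) R →ₐ[R] MvPolynomial (Fin n ⊕ Fin n) R :=
  rename Sum.inr

/-- `D = (∇¹F, …, ∇ⁿF)` is a difference derivative of `F`:
`∑ k, (x_k - y_k) * ∇ᵏF(x,y) = F(x) - F(y)`. -/
def IsDiffDeriv (F : MvPolynomial (Fin n) R)
    (D : Fin n → MvPolynomial (Fin n ⊕ Fin n) R) : Prop :=
  ∑ k : Fin n, (X (Sum.inl k) - X (Sum.inr k)) * D k = toX F - toY F

/-- A difference derivative of `F` is monotonous if each component has total degree
`≤ deg F - 1` (equivalently `deg (∇ᵏF) + 1 ≤ deg F` in `WithBot ℤ`). -/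
def IsMonotonous (F : MvPolynomial (Fin n) R)
    (D : Fin n → MvPolynomial (Fin n ⊕ Fin n) R) : Prop :=
  ∀ k, mdeg (D k) + 1 ≤ mdeg F

/-- `δ_f = ∑ᵢ (deg fᵢ - 1)`. -/
def deltaF (f : Fin n → MvPolynomial (Fin n) R) : ℤ :=
  ∑ i, (((f i).totalDegree : ℤ) - 1)

/-- `(f)^{≤ d}_x`: sums `∑ fᵢ gᵢ` with `deg fᵢ + deg gᵢ ≤ d` for every `i`. -/
def boundedSpan (f : Fin n → MvPolynomial (Fin n) R) (d : WithBot ℤ) :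
    Set (MvPolynomial (Fin n) R) :=
  {F | ∃ g : Fin n → MvPolynomial (Fin n) R,
    F = ∑ i, f i * g i ∧ ∀ i, mdeg (f i) + mdeg (g i) ≤ d}

/-- A linear functional `L` annuls a set `S` if it vanishes on it. -/
def Annuls (L : MvPolynomial (Fin n) R →ₗ[R] R) (S : Set (MvPolynomial (Fin n) R)) : Prop :=
  ∀ F ∈ S, L F = 0

/-- `L(y_*).P` : apply the functional `L` to the `y`-part of `P ∈ R[x,y]`,
i.e. if `P = ∑_α A_α(x) y^α` then `L(y_*).P = ∑_α L(y^α) • A_α(x)`. -/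
def applyY (L : MvPolynomial (Fin n) R →ₗ[R] R) (P : MvPolynomial (Fin n ⊕ Fin n) R) :
    MvPolynomial (Fin n) R :=
  ∑ m ∈ P.support,
    C (L (monomial (Finsupp.sumFinsuppAddEquivProdFinsupp m).2 (1 : R)) * P.coeff m) *
      monomial (Finsupp.sumFinsuppAddEquivProdFinsupp m).1 (1 : R)

/-- `det‖∇f(x,y) ∇F(x,y); f(x) F(x)‖` : the `(n+1) × (n+1)` determinant whose entry `(k,i)`
is `∇ᵏfᵢ(x,y)` for `k, i ≤ n`, entry `(k, n+1)` is `∇ᵏF(x,y)`, entry `(n+1, i)` is `fᵢ(x)`,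
and entry `(n+1, n+1)` is `F(x)`.  Here `Df i` is the tuple `(∇¹fᵢ, …, ∇ⁿfᵢ)`. -/
def ddetX (f : Fin n → MvPolynomial (Fin n) R)
    (Df : Fin n → Fin n → MvPolynomial (Fin n ⊕ Fin n) R)
    (F : MvPolynomial (Fin n) R) (DF : Fin n → MvPolynomial (Fin n ⊕ Fin n) R) :
    MvPolynomial (Fin n ⊕ Fin n) R :=
  Matrix.det (Matrix.of fun k i : Fin (n + 1) =>
    if hk : (k : ℕ) < n then
      if hi : (i : ℕ) < n then Df ⟨i, hi⟩ ⟨k, hk⟩ else DF ⟨k, hk⟩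
    else
      if hi : (i : ℕ) < n then toX (f ⟨i, hi⟩) else toX F)

/-- `det‖∇f(x,y) ∇F(x,y); f(y) F(y)‖` : as `ddetX` but with last row `(f₁(y),…,fₙ(y),F(y))`. -/
def ddetY (f : Fin n → MvPolynomial (Fin n) R)
    (Df : Fin n → Fin n → MvPolynomial (Fin n ⊕ Fin n) R)
    (F : MvPolynomial (Fin n) R) (DF : Fin n → MvPolynomial (Fin n ⊕ Fin n) R) :
    MvPolynomial (Fin n ⊕ Fin n) R :=
  Matrix.det (Matrix.of fun k i : Fin (n + 1) =>
    if hk : (k : ℕ) < n then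
      if hi : (i : ℕ) < n then Df ⟨i, hi⟩ ⟨k, hk⟩ else DF ⟨k, hk⟩
    else
      if hi : (i : ℕ) < n then toY (f ⟨i, hi⟩) else toY F)

/-- Polynomials all of whose monomials have degree at most `e` (an integer). -/
def degLE {σ : Type*} (R : Type*) [CommRing R] (e : ℤ) : Submodule R (MvPolynomial σ R) where
  carrier := {P | ∀ m, P.coeff m ≠ 0 → (m.degree : ℤ) ≤ e}
  zero_mem' := by intro m hm; simp at hm
  add_mem' := by
    intro a b ha hb m hm
    by_cases h : a.coeff m = 0
    · exact hb m (by intro h'; apply hm; rw [coeff_add, h, h', add_zero])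
    · exact ha m h
  smul_mem' := by
    intro c a ha m hm
    exact ha m (by intro h'; apply hm; rw [coeff_smul, h', smul_zero])

section degLemmas
variable {σ : Type*}

theorem mem_degLE {e : ℤ} {P : MvPolynomial σ R} :
    P ∈ degLE R e ↔ ∀ m, P.coeff m ≠ 0 → (m.degree : ℤ) ≤ e := Iff.rfl

theorem degLE_mono {e e' : ℤ} (h : e ≤ e') {P : MvPolynomial σ R} (hP : P ∈ degLE R e) :
    P ∈ degLE R e' := fun m hm => (hP m hm).trans h

theorem degLE_mul {a b : ℤ} {P Q : MvPolynomial σ R} (hP : P ∈ degLE R a) (hQ : Q ∈ degLE R b) :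
    P * Q ∈ degLE R (a + b) := by
  classical
  intro m hm
  have := support_mul P Q (mem_support_iff.2 hm)
  obtain ⟨u, hu, v, hv, rfl⟩ := Finset.mem_add.1 this
  have h1 := hP u (mem_support_iff.1 hu)
  have h2 := hQ v (mem_support_iff.1 hv)
  rw [map_add]; push_cast; omega

theorem degLE_monomial {m : σ →₀ ℕ} {r : R} {e : ℤ} (h : (m.degree : ℤ) ≤ e) :
    monomial m r ∈ degLE R e := by
  classical
  intro m' hm'
  rw [coeff_monomial] at hm'
  split_ifs at hm' with hh
  · rw [← hh]; exact h
  · exact absurd rfl hm'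

theorem degLE_C (r : R) {e : ℤ} (h : 0 ≤ e) : (C r : MvPolynomial σ R) ∈ degLE R e := by
  apply degLE_monomial; simpa using h

theorem degLE_one {e : ℤ} (h : 0 ≤ e) : (1 : MvPolynomial σ R) ∈ degLE R e := degLE_C 1 h

theorem degLE_X (i : σ) : (X i : MvPolynomial σ R) ∈ degLE R 1 := by
  apply degLE_monomial; simp

theorem degLE_rename {τ : Type*} (g : σ → τ) {e : ℤ} {P : MvPolynomial σ R}
    (hP : P ∈ degLE R e) : rename g P ∈ degLE R e := by
  intro m hm
  obtain ⟨u, rfl, hu⟩ := coeff_rename_ne_zero _ _ _ hm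
  rw [Finsupp.degree_mapDomain]
  exact hP u hu

theorem degLE_of_mul_X {i : σ} {e : ℤ} {P : MvPolynomial σ R} (h : P * X i ∈ degLE R e) :
    P ∈ degLE R (e - 1) := by
  intro m hm
  have := h (m + Finsupp.single i 1) (by rwa [coeff_mul_X])
  rw [map_add, Finsupp.degree_single] at this
  push_cast at this; omega

theorem degLE_induct {e : ℤ} {P : MvPolynomial σ R} (hP : P ∈ degLE R e)
    (Q : MvPolynomial σ R → Prop) (h0 : Q 0) (hadd : ∀ a b, Q a → Q b → Q (a + b))
    (hm : ∀ m r, (m.degree : ℤ) ≤ e → Q (monomial m r)) : Q P := by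
  rw [← support_sum_monomial_coeff P]
  exact Finset.sum_induction _ Q hadd h0 fun m hmm => hm m _ (hP m (mem_support_iff.1 hmm))

theorem mdeg_le_iff {e : ℤ} {P : MvPolynomial σ R} :
    mdeg P ≤ (e : WithBot ℤ) ↔ P ∈ degLE R e := by
  unfold mdeg
  rw [Finset.sup_le_iff, mem_degLE]
  refine forall_congr' fun m => ?_
  rw [mem_support_iff]
  refine imp_congr_right fun _ => ?_
  exact WithBot.coe_le_coe

theorem degLE_totalDegree (P : MvPolynomial σ R) : P ∈ degLE R (P.totalDegree : ℤ) := by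
  intro m hm
  exact_mod_cast le_totalDegree (mem_support_iff.2 hm)

theorem mdeg_eq_totalDegree {P : MvPolynomial σ R} (hP : (1 : WithBot ℤ) ≤ mdeg P) :
    mdeg P = ((P.totalDegree : ℤ) : WithBot ℤ) := by
  apply le_antisymm
  · exact mdeg_le_iff.2 (degLE_totalDegree P)
  · have hne : P.support.Nonempty := by
      rw [Finset.nonempty_iff_ne_empty]
      intro h
      simp [mdeg, h] at hP
    obtain ⟨m, hm, hmax⟩ := Finset.exists_mem_eq_sup P.support hne
      (fun m => (m.sum fun _ e => e : ℕ))
    have h2 : P.totalDegree = m.sum fun _ e => e := hmax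
    rw [h2]
    exact Finset.le_sup (f := fun m : σ →₀ ℕ =>
      (((m.sum fun _ e => e : ℕ) : ℤ) : WithBot ℤ)) hm

theorem mdeg_add_le_iff {P Q : MvPolynomial σ R} (hP : (1 : WithBot ℤ) ≤ mdeg P) {e : ℤ} :
    mdeg P + mdeg Q ≤ (e : WithBot ℤ) ↔ Q ∈ degLE R (e - P.totalDegree) := by
  rw [mdeg_eq_totalDegree hP, ← mdeg_le_iff]
  cases h : mdeg Q with
  | bot => simp
  | coe q => 
    rw [← WithBot.coe_add, WithBot.coe_le_coe, WithBot.coe_le_coe]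
    omega

theorem degLE_prod {ι : Type*} (s : Finset ι) (P : ι → MvPolynomial σ R) (c : ι → ℤ)
    (h : ∀ i ∈ s, P i ∈ degLE R (c i)) : ∏ i ∈ s, P i ∈ degLE R (∑ i ∈ s, c i) := by
  classical
  induction s using Finset.induction_on with
  | empty => simpa using degLE_one le_rfl
  | insert a s ha ih =>
    rw [Finset.prod_insert ha, Finset.sum_insert ha]
    exact degLE_mul (h a (Finset.mem_insert_self _ _))
      (ih fun i hi => h i (Finset.mem_insert_of_mem hi))

theorem degLE_det {ι : Type*} [Fintype ι] [DecidableEq ι] (M : Matrix ι ι (MvPolynomial σ R))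
    (r c : ι → ℤ) (h : ∀ k i, M k i ∈ degLE R (r k + c i)) :
    M.det ∈ degLE R (∑ k, r k + ∑ i, c i) := by
  rw [Matrix.det_apply]
  refine Submodule.sum_mem _ fun p _ => ?_
  have := degLE_prod (R := R) univ (fun i => M (p i) i) (fun i => r (p i) + c i) (fun i _ => h _ _)
  rw [Finset.sum_add_distrib, Equiv.sum_comp p r] at this
  rcases Int.units_eq_one_or (Equiv.Perm.sign p) with hs | hs <;> rw [hs]
  · simpa using this
  · simpa using Submodule.neg_mem _ this

theorem X_sub_X_cancel {a b : σ} (hab : a ≠ b) {P : MvPolynomial σ R}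
    (h : (X a - X b) * P = 0) : P = 0 := by
  classical
  let θ : MvPolynomial σ R →ₐ[R] MvPolynomial σ R := aeval (Function.update X a (X a + X b))
  let θ' : MvPolynomial σ R →ₐ[R] MvPolynomial σ R := aeval (Function.update X a (X a - X b))
  have hcomp : θ'.comp θ = AlgHom.id R _ := by
    apply MvPolynomial.algHom_ext
    intro i
    by_cases hi : i = a
    · subst hi; simp [θ, θ', hab.symm]
    · simp [θ, θ', hi]
  have h1 : θ ((X a - X b) * P) = 0 := by rw [h, map_zero]
  rw [map_mul, map_sub] at h1
  have h2 : θ (X a) = X a + X b := by simp [θ]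
  have h3 : θ (X b) = X b := by simp [θ, hab.symm]
  rw [h2, h3, add_sub_cancel_right] at h1
  have h4 : θ P = 0 := by
    have := X_mul_cancel_left_iff (R := R) (i := a) (p := θ P) (q := 0)
    exact this.1 (by rw [h1, mul_zero])
  have h5 := congrArg (fun g => g P) hcomp
  simp only [AlgHom.comp_apply, h4, map_zero] at h5
  simpa using h5.symm

end degLemmas

/-- The difference `x_k - y_k`. -/
def zz (k : Fin n) : MvPolynomial (Fin n ⊕ Fin n) R := X (Sum.inl k) - X (Sum.inr k)

/-- Substitution `x_l ↦ y_l` for `l ∈ S`. -/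
def specS (S : Finset (Fin n)) :
    MvPolynomial (Fin n ⊕ Fin n) R →ₐ[R] MvPolynomial (Fin n ⊕ Fin n) R :=
  rename (Sum.elim (fun l => if l ∈ S then Sum.inr l else Sum.inl l) Sum.inr)

theorem zz_degLE (k : Fin n) : (zz k : MvPolynomial (Fin n ⊕ Fin n) R) ∈ degLE R 1 :=
  Submodule.sub_mem _ (degLE_X _) (degLE_X _)

theorem telescope (S : Finset (Fin n)) {e : ℤ} {P : MvPolynomial (Fin n ⊕ Fin n) R}
    (hP : P ∈ degLE R e) :
    ∃ B : Fin n → MvPolynomial (Fin n ⊕ Fin n) R, (∀ l, B l ∈ degLE R (e - 1)) ∧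
      (∀ l, l ∉ S → B l = 0) ∧ P - specS S P = ∑ l, zz l * B l := by
  refine degLE_induct hP (fun P => ∃ B : Fin n → MvPolynomial (Fin n ⊕ Fin n) R,
    (∀ l, B l ∈ degLE R (e - 1)) ∧
      (∀ l, l ∉ S → B l = 0) ∧ P - specS S P = ∑ l, zz l * B l) ?_ ?_ ?_
  · exact ⟨0, fun l => Submodule.zero_mem _, fun _ _ => rfl, by simp⟩
  · rintro a b ⟨B, h1, h2, h3⟩ ⟨B', h1', h2', h3'⟩
    refine ⟨B + B', fun l => Submodule.add_mem _ (h1 l) (h1' l),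
      fun l hl => by simp [h2 l hl, h2' l hl], ?_⟩
    simp only [Pi.add_apply, mul_add, Finset.sum_add_distrib, ← h3, ← h3', map_add]
    ring
  · intro m r hm
    have key : ∀ (m : Fin n ⊕ Fin n →₀ ℕ) (r : R), ∀ e : ℤ, monomial m r ∈ degLE R e →
      ∃ B : Fin n → MvPolynomial (Fin n ⊕ Fin n) R, (∀ l, B l ∈ degLE R (e - 1)) ∧
      (∀ l, l ∉ S → B l = 0) ∧ monomial m r - specS S (monomial m r) = ∑ l, zz l * B l := by
      refine induction_on_monomial (motive := fun P => ∀ e : ℤ, P ∈ degLE R e →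
        ∃ B : Fin n → MvPolynomial (Fin n ⊕ Fin n) R, (∀ l, B l ∈ degLE R (e - 1)) ∧
      (∀ l, l ∉ S → B l = 0) ∧ P - specS S P = ∑ l, zz l * B l) ?_ ?_
      · intro a e _
        exact ⟨0, fun l => Submodule.zero_mem _, fun _ _ => rfl, by simp [specS]⟩
      · intro p i ih e hp
        have hp' := degLE_of_mul_X hp
        obtain ⟨B, h1, h2, h3⟩ := ih _ hp'
        have hB : ∀ l, B l * X i ∈ degLE R (e - 1) := fun l => by
          have := degLE_mul (h1 l) (degLE_X i)
          exact degLE_mono (by omega) this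
        have hid : p * X i - specS S (p * X i) = ∑ l, zz l * (B l * X i)
            + specS S p * (X i - specS S (X i)) := by
          simp only [← mul_assoc, ← Finset.sum_mul, ← h3, map_mul]
          ring
        by_cases hi : ∃ l ∈ S, i = Sum.inl l
        · obtain ⟨l, hl, rfl⟩ := hi
          refine ⟨fun k => B k * X (Sum.inl l) +
            (Pi.single l (specS S p) : Fin n → MvPolynomial (Fin n ⊕ Fin n) R) k, fun k => ?_,
            fun k hk => ?_, ?_⟩
          · refine Submodule.add_mem _ (hB k) ?_
            by_cases hkl : k = l
            · subst hkl; rw [Pi.single_eq_same]; exact degLE_rename _ hp'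
            · rw [Pi.single_eq_of_ne hkl]; exact Submodule.zero_mem _
          · have hkl : k ≠ l := by rintro rfl; exact hk hl
            simp [h2 k hk, hkl]
          · rw [hid]
            simp only [mul_add, Finset.sum_add_distrib]
            congr 1
            rw [Finset.sum_eq_single l]
            · simp [specS, hl, zz, mul_comm]
            · intro k _ hkl; simp [hkl]
            · simp
        · have hX : specS S (X i : MvPolynomial (Fin n ⊕ Fin n) R) = X i := by
            cases i with
            | inl l =>
              have : l ∉ S := fun hl => hi ⟨l, hl, rfl⟩
              simp [specS, this]
            | inr l => simp [specS]
          refine ⟨fun k => B k * X i, hB, fun k hk => by simp [h2 k hk], ?_⟩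
          rw [hid, hX, sub_self, mul_zero, add_zero]
    exact key m r e (degLE_monomial hm)

theorem exists_diffDeriv {e : ℤ} {g : MvPolynomial (Fin n) R} (hg : g ∈ degLE R e) :
    ∃ B : Fin n → MvPolynomial (Fin n ⊕ Fin n) R, (∀ l, B l ∈ degLE R (e - 1)) ∧
      ∑ l, zz l * B l = toX g - toY g := by
  obtain ⟨B, h1, -, h3⟩ := telescope univ (degLE_rename (Sum.inl : Fin n → Fin n ⊕ Fin n) hg)
  refine ⟨B, h1, ?_⟩
  rw [← h3, specS, rename_rename]
  have : (Sum.elim (fun l => if l ∈ (univ : Finset (Fin n)) then Sum.inr l else Sum.inl l) Sum.inr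
      ∘ Sum.inl : Fin n → Fin n ⊕ Fin n) = Sum.inr := by
    funext l; simp
  rw [this]
  rfl

/-- Exactness of the Koszul complex of the `x_k - y_k` at the first spot, with degree bounds. -/
theorem koszul (Q : AddSubgroup (Fin n → MvPolynomial (Fin n ⊕ Fin n) R)) (e : ℤ)
    (hQ : ∀ (k l : Fin n) (A : MvPolynomial (Fin n ⊕ Fin n) R), A ∈ degLE R (e - 1) →
      A • (Pi.single k (zz l) - Pi.single l (zz k)) ∈ Q)
    (S : Finset (Fin n)) : ∀ (K : Fin n → MvPolynomial (Fin n ⊕ Fin n) R)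
    (_ : ∀ k, K k ∈ degLE R e) (_ : ∀ k, k ∉ S → K k = 0) (_ : ∑ k, zz k * K k = 0), K ∈ Q := by
  induction S using Finset.induction_on with
  | empty =>
    intro K _ h _
    have : K = 0 := funext fun k => h k (Finset.notMem_empty k)
    rw [this]; exact Q.zero_mem
  | insert s S hs ih =>
    intro K hK hsupp hsum
    obtain ⟨B, h1, h2, h3⟩ := telescope S (hK s)
    have hspec : specS S (K s) = 0 := by
      have h := congrArg (specS S) hsum
      rw [map_zero, map_sum, Finset.sum_eq_single s] at h
      · have hz : specS S (zz s : MvPolynomial (Fin n ⊕ Fin n) R) = zz s := by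
          simp [specS, zz, hs]
        rw [map_mul, hz] at h
        exact X_sub_X_cancel (by simp) h
      · intro k _ hk
        by_cases hkS : k ∈ S
        · have : specS S (zz k : MvPolynomial (Fin n ⊕ Fin n) R) = 0 := by
            simp [specS, zz, hkS]
          rw [map_mul, this, zero_mul]
        · rw [hsupp k (by simp [hk, hkS]), mul_zero, map_zero]
      · simp
    rw [hspec, sub_zero] at h3
    have hBs : B s = 0 := h2 s hs
    set G : Fin n → MvPolynomial (Fin n ⊕ Fin n) R :=
      ∑ l, B l • (Pi.single s (zz l) - Pi.single l (zz s)) with hG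
    have hGQ : G ∈ Q := AddSubgroup.sum_mem _ fun l _ => hQ s l _ (h1 l)
    have hGk : ∀ k, G k = (if k = s then K s else 0) - zz s * B k := by
      intro k
      simp only [hG, Finset.sum_apply, Pi.smul_apply, Pi.sub_apply, smul_eq_mul, mul_sub,
        Finset.sum_sub_distrib]
      congr 1
      · split_ifs with h
        · subst h; simp [h3, mul_comm]
        · simp [h]
      · rw [Finset.sum_eq_single k]
        · simp [mul_comm]
        · intro l _ hl; simp [hl.symm]
        · simp
    have hd : K - G ∈ Q := by
      apply ih
      · intro k
        rw [Pi.sub_apply, hGk]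
        have hb : zz s * B k ∈ degLE R e := degLE_mono (by omega) (degLE_mul (zz_degLE s) (h1 k))
        refine Submodule.sub_mem _ (hK k) (Submodule.sub_mem _ ?_ hb)
        split_ifs
        · exact hK s
        · exact Submodule.zero_mem _
      · intro k hk
        rw [Pi.sub_apply, hGk, h2 k hk]
        split_ifs with h
        · subst h; simp
        · rw [hsupp k (by simp [h, hk])]; simp
      · simp only [Pi.sub_apply, mul_sub, Finset.sum_sub_distrib, hsum, hGk]
        simp only [mul_ite, mul_zero, Finset.sum_ite_eq', Finset.mem_univ, if_true]
        have : ∑ x, zz x * (zz s * B x) = zz s * K s := by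
          rw [h3, Finset.mul_sum]
          exact Finset.sum_congr rfl fun x _ => by ring
        rw [this]; ring
    have := Q.add_mem hd hGQ
    simpa using this

section Matrices
variable {T : Type*} [CommRing T]

/-- The bordered matrix, indexed by `Fin n ⊕ Fin 1`. -/
def bord (J : Fin n → Fin n → T) (v : Fin n → T) (p : Fin n → T) (c : T) :
    Matrix (Fin n ⊕ Fin 1) (Fin n ⊕ Fin 1) T :=
  Matrix.fromBlocks (Matrix.of fun k i => J i k) (Matrix.of fun k _ => v k)
    (Matrix.of fun _ i => p i) (Matrix.of fun _ _ => c)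

theorem bord_eq_updateCol (J : Fin n → Fin n → T) (v : Fin n → T) (p : Fin n → T) (c : T) :
    bord J v p c = (bord J 0 p 0).updateCol (Sum.inr 0) (Sum.elim v (fun _ => c)) := by
  ext k i
  rcases k with k | k <;> rcases i with i | i <;>
    simp [bord, Matrix.updateCol_apply, Fin.fin_one_eq_zero]

/-- The bordered determinant with corner `0` as a linear map in the last column. -/
def bordDet (J : Fin n → Fin n → T) (p : Fin n → T) : (Fin n → T) →ₗ[T] T where
  toFun v := (bord J v p 0).det
  map_add' v w := by
    rw [bord_eq_updateCol, bord_eq_updateCol J v, bord_eq_updateCol J w,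
      ← Matrix.det_updateCol_add]
    congr 2
    ext k; rcases k with k | k <;> simp
  map_smul' a v := by
    rw [bord_eq_updateCol, bord_eq_updateCol J v, RingHom.id_apply, smul_eq_mul,
      ← Matrix.det_updateCol_smul]
    congr 2
    ext k; rcases k with k | k <;> simp

theorem bord_colop (J : Fin n → Fin n → T) (v : Fin n → T) (p g : Fin n → T) :
    (bord J v p (∑ i, p i * g i)).det = bordDet J p (v - ∑ i, g i • J i) := by
  have h : bord J (v - ∑ i, g i • J i) p 0 = bord J v p (∑ i, p i * g i) *
      Matrix.fromBlocks 1 (Matrix.of fun i _ => - g i) 0 1 := by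
    rw [bord, bord, Matrix.fromBlocks_multiply]
    congr 1
    · simp
    · ext k i
      simp [Matrix.mul_apply, mul_comm, sub_eq_add_neg, add_comm]
    · simp
    · ext k i
      simp [Matrix.mul_apply]
  change _ = (bord J (v - ∑ i, g i • J i) p 0).det
  rw [h, Matrix.det_mul, Matrix.det_fromBlocks_zero₂₁]
  simp

theorem det_row_expand {ι : Type*} [Fintype ι] [DecidableEq ι] (M : Matrix ι ι T) (r : ι) :
    M.det = ∑ j, M r j * (M.updateRow r (Pi.single j 1)).det := by
  rw [Matrix.det_eq_sum_mul_adjugate_row M r]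
  simp only [Matrix.adjugate_apply]

/-- The doubly bordered matrix. -/
def bord2 (J : Fin n → Fin n → T) (u w : Fin n → T) (p q : Fin n → T) (b c : T) :
    Matrix ((Fin n ⊕ Fin 1) ⊕ Fin 1) ((Fin n ⊕ Fin 1) ⊕ Fin 1) T :=
  Matrix.fromBlocks (bord J u p 0) (Matrix.of fun k _ => Sum.elim w (fun _ => 0) k)
    (Matrix.of fun _ i => Sum.elim q (fun _ => b) i) (Matrix.of fun _ _ => c)

theorem bord2_det_zero (J : Fin n → Fin n → T) (u w : Fin n → T) (p : Fin n → T) (b c : T) :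
    (bord2 J u w p 0 b c).det = bordDet J p (c • u - b • w) := by
  have h1 : ((bord2 J u w p 0 b c).updateRow (Sum.inr 0) (Pi.single (Sum.inr 0) 1)).det
      = bordDet J p u := by
    have : (bord2 J u w p 0 b c).updateRow (Sum.inr 0) (Pi.single (Sum.inr 0) 1) =
        Matrix.fromBlocks (bord J u p 0)
          (Matrix.of fun k _ => Sum.elim w (fun _ => 0) k) 0 1 := by
      ext k i
      rcases k with k | k <;> rcases i with i | i <;>
        simp [bord2, Matrix.updateRow_apply, Pi.single_apply, Fin.fin_one_eq_zero]
    rw [this, Matrix.det_fromBlocks_zero₂₁, Matrix.det_one, mul_one]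
    rfl
  have h2 : ((bord2 J u w p 0 b c).updateRow (Sum.inr 0)
      (Pi.single (Sum.inl (Sum.inr 0)) 1)).det = - bordDet J p w := by
    have h3 := Matrix.det_permute'
      (Equiv.swap (Sum.inl (Sum.inr 0) : (Fin n ⊕ Fin 1) ⊕ Fin 1) (Sum.inr 0))
      ((bord2 J u w p 0 b c).updateRow (Sum.inr 0) (Pi.single (Sum.inl (Sum.inr 0)) 1))
    have : ((bord2 J u w p 0 b c).updateRow (Sum.inr 0)
        (Pi.single (Sum.inl (Sum.inr 0)) 1)).submatrix id
        (Equiv.swap (Sum.inl (Sum.inr 0) : (Fin n ⊕ Fin 1) ⊕ Fin 1) (Sum.inr 0)) =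
        Matrix.fromBlocks (bord J w p 0)
          (Matrix.of fun k _ => Sum.elim u (fun _ => 0) k) 0 1 := by
      ext k i
      rcases i with (i | i) | i
      · have hs : Equiv.swap (Sum.inl (Sum.inr 0) : (Fin n ⊕ Fin 1) ⊕ Fin 1) (Sum.inr 0)
            (Sum.inl (Sum.inl i)) = Sum.inl (Sum.inl i) :=
          Equiv.swap_apply_of_ne_of_ne (by simp) (by simp)
        rw [Matrix.submatrix_apply, hs]
        rcases k with (k | k) | k <;>
          simp [bord2, bord, Matrix.updateRow_apply, Fin.fin_one_eq_zero]
      · rw [Subsingleton.elim i 0, Matrix.submatrix_apply, Equiv.swap_apply_left]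
        rcases k with (k | k) | k <;>
          simp [bord2, bord, Matrix.updateRow_apply, Fin.fin_one_eq_zero]
      · rw [Subsingleton.elim i 0, Matrix.submatrix_apply, Equiv.swap_apply_right]
        rcases k with (k | k) | k <;>
          simp [bord2, bord, Matrix.updateRow_apply, Fin.fin_one_eq_zero]
    rw [this, Matrix.det_fromBlocks_zero₂₁, Matrix.det_one, mul_one,
      Equiv.Perm.sign_swap (by simp)] at h3
    change bordDet J p w = _ at h3
    rw [h3]; simp
  rw [det_row_expand _ (Sum.inr 0), Fintype.sum_sum_type, Fintype.sum_sum_type]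
  simp only [Finset.univ_unique, Finset.sum_singleton, Fin.default_eq_zero, h1, h2]
  simp [bord2, sub_eq_add_neg, add_comm]

theorem bord2_rowop (J : Fin n → Fin n → T) (u w : Fin n → T) (p q z : Fin n → T)
    (hz : ∀ i, ∑ k, z k * J i k = p i - q i) :
    (bord2 J u w p q 0 0).det =
      bordDet J p ((∑ k, z k * w k) • u - (∑ k, z k * u k) • w) := by
  have h : bord2 J u w p 0 (∑ k, z k * u k) (∑ k, z k * w k) =
      Matrix.fromBlocks 1 0 (Matrix.of fun _ i => Sum.elim z (fun _ => -1) i) 1 *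
      bord2 J u w p q 0 0 := by
    rw [bord2, bord2, Matrix.fromBlocks_multiply]
    congr 1
    · simp
    · simp
    · ext k i
      rcases i with i | i
      · simp [Matrix.mul_apply, bord, hz]
        ring
      · simp [Matrix.mul_apply, bord]
    · ext k i
      simp [Matrix.mul_apply]
  rw [← bord2_det_zero, h, Matrix.det_mul, Matrix.det_fromBlocks_zero₁₂]
  simp

end Matrices

theorem ddetX_eq (f : Fin n → MvPolynomial (Fin n) R)
    (Df : Fin n → Fin n → MvPolynomial (Fin n ⊕ Fin n) R)
    (F : MvPolynomial (Fin n) R) (DF : Fin n → MvPolynomial (Fin n ⊕ Fin n) R) :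
    ddetX f Df F DF = (bord Df DF (fun i => toX (f i)) (toX F)).det := by
  rw [ddetX, ← Matrix.det_submatrix_equiv_self finSumFinEquiv]
  congr 1
  ext1 k i
  rcases k with k | k <;> rcases i with i | i <;> simp [bord]

/-- Span of the products `f_j(x) f_i(y) G` with the right degree bound on `G`. -/
def spanW (f : Fin n → MvPolynomial (Fin n) R) (d : ℤ) :
    Submodule R (MvPolynomial (Fin n ⊕ Fin n) R) :=
  Submodule.span R {P | ∃ i j, ∃ G ∈ degLE R
    (deltaF f + d - (f i).totalDegree - (f j).totalDegree), P = toY (f i) * (toX (f j) * G)}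

theorem single_degLE {ι σ : Type*} [DecidableEq ι] (i j : ι) {e : ℤ} (h : i = j → 0 ≤ e) :
    (Pi.single i 1 : ι → MvPolynomial σ R) j ∈ degLE R e := by
  by_cases hij : j = i
  · subst hij; rw [Pi.single_eq_same]; exact degLE_one (h rfl)
  · rw [Pi.single_eq_of_ne hij]; exact Submodule.zero_mem _

theorem caseOne (f : Fin n → MvPolynomial (Fin n) R)
    (Df : Fin n → Fin n → MvPolynomial (Fin n ⊕ Fin n) R)
    (hDf : ∀ i k, Df i k ∈ degLE R ((f i).totalDegree - 1)) (d : ℤ) (i : Fin n)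
    (w : Fin n → MvPolynomial (Fin n ⊕ Fin n) R)
    (hw : ∀ k, w k ∈ degLE R (d - (f i).totalDegree - 1)) :
    bordDet Df (fun i => toX (f i)) (toY (f i) • w) ∈ spanW f d := by
  rw [map_smul, smul_eq_mul]
  change _ * (bord Df w (fun i => toX (f i)) 0).det ∈ _
  rw [det_row_expand _ (Sum.inr 0), Fintype.sum_sum_type, mul_add,
    Finset.mul_sum]
  refine Submodule.add_mem _ (Submodule.sum_mem _ fun j _ => ?_) (by simp [bord])
  refine Submodule.subset_span ⟨i, j, _, ?_, rfl⟩
  have := degLE_det ((bord Df w (fun i => toX (f i)) 0).updateRow (Sum.inr 0)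
    (Pi.single (Sum.inl j) 1))
    (Sum.elim (fun _ => 0) (fun _ => -((f j).totalDegree - 1)))
    (Sum.elim (fun i => (f i).totalDegree - 1) (fun _ => d - (f i).totalDegree - 1)) ?_
  · refine degLE_mono ?_ this
    simp [deltaF]
    omega
  · intro k l
    rcases k with k | k
    · rw [Matrix.updateRow_ne (by simp)]
      rcases l with l | l
      · simpa [bord] using hDf l k
      · simpa [bord] using hw k
    · rw [Subsingleton.elim k 0, Matrix.updateRow_self]
      apply single_degLE
      rintro rfl
      simp

theorem caseTwo (f : Fin n → MvPolynomial (Fin n) R)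
    (Df : Fin n → Fin n → MvPolynomial (Fin n ⊕ Fin n) R)
    (hDf : ∀ i k, Df i k ∈ degLE R ((f i).totalDegree - 1))
    (hDf' : ∀ i, ∑ k, zz k * Df i k = toX (f i) - toY (f i)) (d : ℤ) (k l : Fin n)
    (A : MvPolynomial (Fin n ⊕ Fin n) R) (hA : A ∈ degLE R (d - 2)) :
    bordDet Df (fun i => toX (f i)) (A • (Pi.single k (zz l) - Pi.single l (zz k)))
      ∈ spanW f d := by
  rw [map_smul, smul_eq_mul]
  have h := bord2_rowop Df (Pi.single k 1) (Pi.single l 1) (fun i => toX (f i))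
    (fun i => toY (f i)) zz hDf'
  have e1 : ∀ l : Fin n, ∑ k, zz k * (Pi.single l 1 : Fin n →
      MvPolynomial (Fin n ⊕ Fin n) R) k = zz l := by
    intro l; simp [Pi.single_apply]
  rw [e1, e1, ← Pi.single_smul, ← Pi.single_smul, smul_eq_mul, smul_eq_mul, mul_one, mul_one] at h
  rw [← h, det_row_expand _ (Sum.inr 0), Fintype.sum_sum_type, Fintype.sum_sum_type, mul_add,
    mul_add, Finset.mul_sum]
  refine Submodule.add_mem _ (Submodule.add_mem _ (Submodule.sum_mem _ fun i _ => ?_)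
    (by simp [bord2])) (by simp [bord2])
  rw [det_row_expand _ (Sum.inl (Sum.inr 0)), Fintype.sum_sum_type, Fintype.sum_sum_type, mul_add,
    mul_add, mul_add, mul_add, Finset.mul_sum, Finset.mul_sum]
  refine Submodule.add_mem _ (Submodule.add_mem _ (Submodule.sum_mem _ fun j _ => ?_)
    (by simp [bord2, bord])) (by simp [bord2, bord])
  set N := bord2 Df (Pi.single k 1) (Pi.single l 1) (fun i => toX (f i))
    (fun i => toY (f i)) 0 0 with hN
  have hG := degLE_det (R := R) ((N.updateRow (Sum.inr 0) (Pi.single (Sum.inl (Sum.inl i)) 1)).updateRow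
    (Sum.inl (Sum.inr 0)) (Pi.single (Sum.inl (Sum.inl j)) 1))
    (Sum.elim (Sum.elim (fun _ => 0) (fun _ => -((f j).totalDegree - 1)))
      (fun _ => -((f i).totalDegree - 1)))
    (Sum.elim (Sum.elim (fun i => (f i).totalDegree - 1) (fun _ => 0)) (fun _ => 0)) ?_
  · refine Submodule.subset_span ⟨i, j, A * ((N.updateRow (Sum.inr 0) (Pi.single (Sum.inl (Sum.inl i)) 1)).updateRow
        (Sum.inl (Sum.inr 0)) (Pi.single (Sum.inl (Sum.inl j)) 1)).det, ?_, ?_⟩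
    · refine degLE_mono ?_ (degLE_mul hA hG)
      simp [deltaF]
      omega
    · have a1 : N (Sum.inr 0) (Sum.inl (Sum.inl i)) = toY (f i) := by simp [hN, bord2]
      have a2 : (N.updateRow (Sum.inr 0) (Pi.single (Sum.inl (Sum.inl i)) 1))
          (Sum.inl (Sum.inr 0)) (Sum.inl (Sum.inl j)) = toX (f j) := by
        rw [Matrix.updateRow_ne (by simp)]
        simp [hN, bord2, bord]
      rw [a1, a2]
      ring
  · intro a b
    rcases a with (a | a) | a
    · rw [Matrix.updateRow_ne (by simp), Matrix.updateRow_ne (by simp)]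
      rcases b with (b | b) | b
      · simpa [hN, bord2, bord] using hDf b a
      · simpa [hN, bord2, bord] using single_degLE (R := R) (σ := Fin n ⊕ Fin n) k a (fun _ => le_refl 0)
      · simpa [hN, bord2, bord] using single_degLE (R := R) (σ := Fin n ⊕ Fin n) l a (fun _ => le_refl 0)
    · rw [Subsingleton.elim a 0, Matrix.updateRow_self]
      apply single_degLE
      rintro rfl
      simp
    · rw [Matrix.updateRow_ne (by simp), Subsingleton.elim a 0, Matrix.updateRow_self]
      apply single_degLE
      rintro rfl
      simp

theorem applyY_eq_sum (L : MvPolynomial (Fin n) R →ₗ[R] R)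
    (P : MvPolynomial (Fin n ⊕ Fin n) R) (s : Finset (Fin n ⊕ Fin n →₀ ℕ)) (hs : P.support ⊆ s) :
    applyY L P = ∑ m ∈ s,
    C (L (monomial (Finsupp.sumFinsuppAddEquivProdFinsupp m).2 (1 : R)) * P.coeff m) *
      monomial (Finsupp.sumFinsuppAddEquivProdFinsupp m).1 (1 : R) := by
  rw [applyY]
  refine Finset.sum_subset hs fun m _ hm => ?_
  rw [notMem_support_iff.1 hm, mul_zero, C_0, zero_mul]

/-- `applyY L` as a linear map. -/
def applyYLin (L : MvPolynomial (Fin n) R →ₗ[R] R) :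
    MvPolynomial (Fin n ⊕ Fin n) R →ₗ[R] MvPolynomial (Fin n) R where
  toFun := applyY L
  map_add' P Q := by
    classical
    rw [applyY_eq_sum L (P + Q) (P.support ∪ Q.support) support_add,
      applyY_eq_sum L P (P.support ∪ Q.support) Finset.subset_union_left,
      applyY_eq_sum L Q (P.support ∪ Q.support) Finset.subset_union_right,
      ← Finset.sum_add_distrib]
    refine Finset.sum_congr rfl fun m _ => ?_
    rw [coeff_add, mul_add, C_add, add_mul]
  map_smul' a P := by
    rw [applyY_eq_sum L (a • P) P.support support_smul, applyY, RingHom.id_apply, Finset.smul_sum]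
    refine Finset.sum_congr rfl fun m _ => ?_
    rw [coeff_smul, smul_eq_mul, smul_eq_C_mul]
    simp only [C_mul]
    ring

theorem applyYLin_monomial (L : MvPolynomial (Fin n) R →ₗ[R] R) (a b : Fin n →₀ ℕ) (r s : R) :
    applyYLin L (toX (monomial a r) * toY (monomial b s)) = monomial a r * C (L (monomial b s)) := by
  classical
  have h0 : toX (monomial a r) * toY (monomial b s) =
      monomial (Finsupp.sumFinsuppAddEquivProdFinsupp.symm (a, b)) (r * s) := by
    rw [toX, toY, rename_monomial, rename_monomial, monomial_mul]
    congr 2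
    apply Finsupp.sumFinsuppAddEquivProdFinsupp.injective
    rw [map_add, AddEquiv.apply_symm_apply]
    ext i <;> simp [Finsupp.mapDomain_apply Sum.inl_injective,
            Finsupp.mapDomain_apply Sum.inr_injective, Finsupp.mapDomain_of_notMem_range]
  rw [h0]
  change applyY L _ = _
  rw [applyY_eq_sum L _ _ support_monomial_subset, Finset.sum_singleton,
    AddEquiv.apply_symm_apply, coeff_monomial, if_pos rfl]
  have h1 : (monomial b s : MvPolynomial (Fin n) R) = s • monomial b 1 := by
    rw [smul_monomial, smul_eq_mul, mul_one]
  have h2 : (monomial a r : MvPolynomial (Fin n) R) = C r * monomial a 1 := by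
    rw [C_mul_monomial, mul_one]
  rw [h1, h2, map_smul, smul_eq_mul]
  simp only [C_mul]
  ring

theorem applyYLin_mul (L : MvPolynomial (Fin n) R →ₗ[R] R) (P Q : MvPolynomial (Fin n) R) :
    applyYLin L (toX P * toY Q) = P * C (L Q) := by
  induction P using MvPolynomial.induction_on' with
  | add p q hp hq => rw [map_add, add_mul, map_add, hp, hq, add_mul]
  | monomial a r =>
    induction Q using MvPolynomial.induction_on' with
    | add p q hp hq => rw [map_add, mul_add, map_add, hp, hq, map_add, C_add, mul_add]
    | monomial b s => exact applyYLin_monomial L a b r s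

theorem boundedSpan_iff (f : Fin n → MvPolynomial (Fin n) R)
    (hf : ∀ i, (1 : WithBot ℤ) ≤ mdeg (f i)) (e : ℤ) (P : MvPolynomial (Fin n) R) :
    P ∈ boundedSpan f (e : WithBot ℤ) ↔ ∃ g : Fin n → MvPolynomial (Fin n) R,
      P = ∑ i, f i * g i ∧ ∀ i, g i ∈ degLE R (e - (f i).totalDegree) := by
  simp only [boundedSpan, Set.mem_ofPred_eq, mdeg_add_le_iff (hf _)]

theorem boundedSpan_zero (f : Fin n → MvPolynomial (Fin n) R)
    (hf : ∀ i, (1 : WithBot ℤ) ≤ mdeg (f i)) (e : ℤ) :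
    (0 : MvPolynomial (Fin n) R) ∈ boundedSpan f (e : WithBot ℤ) := by
  rw [boundedSpan_iff f hf]
  exact ⟨0, by simp, fun i => Submodule.zero_mem _⟩

theorem boundedSpan_add (f : Fin n → MvPolynomial (Fin n) R)
    (hf : ∀ i, (1 : WithBot ℤ) ≤ mdeg (f i)) (e : ℤ) (P Q : MvPolynomial (Fin n) R)
    (hP : P ∈ boundedSpan f (e : WithBot ℤ)) (hQ : Q ∈ boundedSpan f (e : WithBot ℤ)) :
    P + Q ∈ boundedSpan f (e : WithBot ℤ) := by
  rw [boundedSpan_iff f hf] at *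
  obtain ⟨g, rfl, hg⟩ := hP
  obtain ⟨g', rfl, hg'⟩ := hQ
  exact ⟨g + g', by simp [mul_add, Finset.sum_add_distrib],
    fun i => Submodule.add_mem _ (hg i) (hg' i)⟩

theorem boundedSpan_smul (f : Fin n → MvPolynomial (Fin n) R)
    (hf : ∀ i, (1 : WithBot ℤ) ≤ mdeg (f i)) (e : ℤ) (a : R) (P : MvPolynomial (Fin n) R)
    (hP : P ∈ boundedSpan f (e : WithBot ℤ)) :
    a • P ∈ boundedSpan f (e : WithBot ℤ) := by
  rw [boundedSpan_iff f hf] at *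
  obtain ⟨g, rfl, hg⟩ := hP
  exact ⟨a • g, by simp [Finset.smul_sum],
    fun i => Submodule.smul_mem _ _ (hg i)⟩

theorem boundedSpan_single (f : Fin n → MvPolynomial (Fin n) R)
    (hf : ∀ i, (1 : WithBot ℤ) ≤ mdeg (f i)) (e : ℤ) (j : Fin n) (P : MvPolynomial (Fin n) R)
    (hP : P ∈ degLE R (e - (f j).totalDegree)) :
    f j * P ∈ boundedSpan f (e : WithBot ℤ) := by
  rw [boundedSpan_iff f hf]
  refine ⟨Pi.single j P, ?_, fun i => ?_⟩
  · rw [Finset.sum_eq_single j] <;> simp +contextual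
  · by_cases h : i = j
    · subst h; simpa using hP
    · simp [h]

theorem applyYLin_mem (f : Fin n → MvPolynomial (Fin n) R)
    (hf : ∀ i, (1 : WithBot ℤ) ≤ mdeg (f i))
    (δ : ℤ) (L : MvPolynomial (Fin n) R →ₗ[R] R)
    (hL : Annuls L (boundedSpan f ((deltaF f + δ : ℤ) : WithBot ℤ))) (d : ℤ)
    (P : MvPolynomial (Fin n ⊕ Fin n) R) (hP : P ∈ spanW f d) :
    applyYLin L P ∈ boundedSpan f ((d - δ - 1 : ℤ) : WithBot ℤ) := by
  rw [spanW] at hP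
  induction hP using Submodule.span_induction with
  | zero => rw [map_zero]; exact boundedSpan_zero f hf _
  | add x y _ _ hx hy => rw [map_add]; exact boundedSpan_add f hf _ _ _ hx hy
  | smul a x _ hx => rw [map_smul]; exact boundedSpan_smul f hf _ _ _ hx
  | mem x hx =>
    obtain ⟨i, j, G, hG, rfl⟩ := hx
    refine degLE_induct hG (fun G => applyYLin L (toY (f i) * (toX (f j) * G)) ∈
      boundedSpan f ((d - δ - 1 : ℤ) : WithBot ℤ)) ?_ ?_ ?_
    · simpa using boundedSpan_zero f hf _
    · intro a b ha hb
      rw [mul_add, mul_add, map_add]; exact boundedSpan_add f hf _ _ _ ha hb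
    · intro m r hm
      obtain ⟨⟨a, b⟩, rfl⟩ := Finsupp.sumFinsuppAddEquivProdFinsupp.symm.surjective m
      have h0 : toX (monomial a r) * toY (monomial b 1) =
          monomial (Finsupp.sumFinsuppAddEquivProdFinsupp.symm (a, b)) r ∧
          (Finsupp.sumFinsuppAddEquivProdFinsupp.symm (a, b)).degree = a.degree + b.degree := by
        have : Finsupp.sumFinsuppAddEquivProdFinsupp.symm (a, b) =
            a.mapDomain Sum.inl + b.mapDomain Sum.inr := by
          apply Finsupp.sumFinsuppAddEquivProdFinsupp.injective
          rw [map_add, AddEquiv.apply_symm_apply]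
          ext i <;> simp [Finsupp.mapDomain_apply Sum.inl_injective,
            Finsupp.mapDomain_apply Sum.inr_injective, Finsupp.mapDomain_of_notMem_range]
        rw [this, map_add, Finsupp.degree_mapDomain, Finsupp.degree_mapDomain]
        refine ⟨?_, rfl⟩
        rw [toX, toY, rename_monomial, rename_monomial, monomial_mul, mul_one]
      rw [h0.2] at hm
      have h1 : toY (f i) * (toX (f j) *
          monomial (Finsupp.sumFinsuppAddEquivProdFinsupp.symm (a, b)) r) =
          toX (f j * monomial a r) * toY (f i * monomial b 1) := by
        rw [← h0.1, map_mul, map_mul]; ring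
      rw [h1, applyYLin_mul]
      by_cases hb : (b.degree : ℤ) ≤ deltaF f + δ - (f i).totalDegree
      · rw [hL _ (boundedSpan_single f hf _ i _ (degLE_monomial hb)), C_0, mul_zero]
        exact boundedSpan_zero f hf _
      · rw [mul_assoc]
        apply boundedSpan_single f hf
        rw [mul_comm, ← smul_eq_C_mul]
        apply Submodule.smul_mem
        apply degLE_monomial
        push_cast at hm
        omega

theorem degLE_of_mdeg_add_one {σ : Type*} {P : MvPolynomial σ R} {e : ℤ}
    (h : mdeg P + 1 ≤ (e : WithBot ℤ)) : P ∈ degLE R (e - 1) := by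
  rw [← mdeg_le_iff]
  cases hq : mdeg P with
  | bot => simp
  | coe q =>
    rw [hq] at h
    have h' : ((q + 1 : ℤ) : WithBot ℤ) ≤ (e : WithBot ℤ) := h
    rw [WithBot.coe_le_coe] at h' ⊢
    omega

theorem ddetX_mem_spanW (f : Fin n → MvPolynomial (Fin n) R)
    (hf : ∀ i, (1 : WithBot ℤ) ≤ mdeg (f i))
    (Df : Fin n → Fin n → MvPolynomial (Fin n ⊕ Fin n) R)
    (hDf : ∀ i, IsDiffDeriv (f i) (Df i) ∧ IsMonotonous (f i) (Df i))
    (d : ℤ) (F : MvPolynomial (Fin n) R) (hF : F ∈ boundedSpan f ((d : ℤ) : WithBot ℤ))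
    (DF : Fin n → MvPolynomial (Fin n ⊕ Fin n) R)
    (hDF : IsDiffDeriv F DF ∧ IsMonotonous F DF) :
    ddetX f Df F DF ∈ spanW f d := by
  rw [boundedSpan_iff f hf] at hF
  obtain ⟨g, hFg, hg⟩ := hF
  have hJ : ∀ i k, Df i k ∈ degLE R ((f i).totalDegree - 1) := fun i k =>
    degLE_of_mdeg_add_one (by rw [← mdeg_eq_totalDegree (hf i)]; exact (hDf i).2 k)
  have hJ' : ∀ i, ∑ k, zz k * Df i k = toX (f i) - toY (f i) := fun i => (hDf i).1
  have hFd : F ∈ degLE R d := by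
    rw [hFg]
    refine Submodule.sum_mem _ fun i _ => ?_
    exact degLE_mono (by omega) (degLE_mul (degLE_totalDegree (f i)) (hg i))
  have hDFd : ∀ k, DF k ∈ degLE R (d - 1) := fun k =>
    degLE_of_mdeg_add_one ((hDF.2 k).trans (mdeg_le_iff.2 hFd))
  choose B hB hB' using fun i => exists_diffDeriv (hg i)
  have hX : toX F = ∑ i, toX (f i) * toX (g i) := by
    rw [hFg, map_sum]; simp only [map_mul]
  have hY : toY F = ∑ i, toY (f i) * toY (g i) := by
    rw [hFg, map_sum]; simp only [map_mul]
  rw [ddetX_eq, hX, bord_colop Df DF (fun i => toX (f i)) (fun i => toX (g i))]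
  set v := DF - ∑ i, toX (g i) • Df i with hv
  set K := v - ∑ i, toY (f i) • B i with hK
  have hvK : v = K + ∑ i, toY (f i) • B i := by rw [hK]; abel
  rw [hvK, map_add, map_sum]
  refine Submodule.add_mem _ ?_ (Submodule.sum_mem _ fun i _ => ?_)
  · have := koszul ((spanW f d).toAddSubgroup.comap
      (bordDet Df (fun i => toX (f i))).toAddMonoidHom) (d - 1) ?_ univ K ?_ (by simp) ?_
    · exact this
    · intro k l A hA
      exact caseTwo f Df hJ hJ' d k l A (degLE_mono (by omega) hA)
    · intro k
      simp only [hK, hv, Pi.sub_apply, Finset.sum_apply, Pi.smul_apply, smul_eq_mul]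
      refine Submodule.sub_mem _ (Submodule.sub_mem _ (hDFd k)
        (Submodule.sum_mem _ fun i _ => ?_)) (Submodule.sum_mem _ fun i _ => ?_)
      · exact degLE_mono (by omega) (degLE_mul (degLE_rename Sum.inl (hg i)) (hJ i k))
      · exact degLE_mono (by omega)
          (degLE_mul (degLE_rename Sum.inr (degLE_totalDegree (f i))) (hB i k))
    · have h1 : ∑ k, zz k * DF k = toX F - toY F := hDF.1
      have h2 : ∀ (c : Fin n → MvPolynomial (Fin n ⊕ Fin n) R)
          (V : Fin n → Fin n → MvPolynomial (Fin n ⊕ Fin n) R),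
          ∑ k, zz k * ∑ i, c i * V i k = ∑ i, c i * ∑ k, zz k * V i k := by
        intro c V
        simp only [Finset.mul_sum]
        rw [Finset.sum_comm]
        exact Finset.sum_congr rfl fun i _ => Finset.sum_congr rfl fun k _ => by ring
      simp only [hK, hv, Pi.sub_apply, Finset.sum_apply, Pi.smul_apply, smul_eq_mul, mul_sub,
        Finset.sum_sub_distrib, h2, h1, hJ', hB', hX, hY]
      simp only [← Finset.sum_sub_distrib]
      exact Finset.sum_eq_zero fun i _ => by ring
  · exact caseOne f Df hJ d i (B i) (hB i)

/-- Theorem 2.3: if `F ∈ (f)^{≤ d}_x`, then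
`H(x) = L(y_*).det‖∇f ∇F; f(x) F(x)‖ ∈ (f)^{≤ d - δ - 1}_x`. -/
theorem applyY_ddetX_mem_of_mem {R : Type*} [CommRing R] {n : ℕ}
    (f : Fin n → MvPolynomial (Fin n) R) (hf : ∀ i, (1 : WithBot ℤ) ≤ mdeg (f i))
    (δ : ℤ) (hδ : 0 ≤ δ) (L : MvPolynomial (Fin n) R →ₗ[R] R)
    (hL : Annuls L (boundedSpan f ((deltaF f + δ : ℤ) : WithBot ℤ)))
    (Df : Fin n → Fin n → MvPolynomial (Fin n ⊕ Fin n) R)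
    (hDf : ∀ i, IsDiffDeriv (f i) (Df i) ∧ IsMonotonous (f i) (Df i))
    (d : ℤ) (F : MvPolynomial (Fin n) R) (hF : F ∈ boundedSpan f ((d : ℤ) : WithBot ℤ))
    (DF : Fin n → MvPolynomial (Fin n ⊕ Fin n) R)
    (hDF : IsDiffDeriv F DF ∧ IsMonotonous F DF) :
    applyY L (ddetX f Df F DF) ∈ boundedSpan f ((d - δ - 1 : ℤ) : WithBot ℤ) := by
  exact applyYLin_mem f hf δ L hL d _ (ddetX_mem_spanW f hf Df hDf d F hF DF hDF)

end
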